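/- Let V = ℚ[X]_{(X)} = ℚ + XV and R = ℤ + XV. Then gldim(R) = 2, wdim(R) = 1, and cot.D(R) = 1; in particular cot.D(R) < gldim(R) and gldim(R) = cot.D(R) + wdim(R). -/

import Mathlib

open CategoryTheory Opposite

noncomputable section

universe u

variable (R : Type u) [CommRing R]

/-- `ExtVanish R M N n` : the `n`-th Ext group `Ext^n_R(M, N)` vanishes. -/
def ExtVanish (M N : ModuleCat.{u} R) (n : ℕ) : Prop :=
  Subsingleton (((Ext R (ModuleCat.{u} R) n).obj (op M)).obj N)

/-- `TorVanish R M N n` : the `n`-th Tor group `Tor_n^R(M, N)` vanishes. -/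
def TorVanish (M N : ModuleCat.{u} R) (n : ℕ) : Prop :=
  Subsingleton (((Tor (ModuleCat.{u} R) n).obj M).obj N)

/-- `pdLE R M n` : the projective dimension of `M` is at most `n`. -/
def pdLE (M : ModuleCat.{u} R) (n : ℕ) : Prop :=
  ∀ N : ModuleCat.{u} R, ExtVanish R M N (n + 1)

/-- `idLE R M n` : the injective dimension of `M` is at most `n`. -/
def idLE (M : ModuleCat.{u} R) (n : ℕ) : Prop :=
  ∀ N : ModuleCat.{u} R, ExtVanish R N M (n + 1)

/-- `fdLE R M n` : the flat dimension of `M` is at most `n`. -/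
def fdLE (M : ModuleCat.{u} R) (n : ℕ) : Prop :=
  ∀ N : ModuleCat.{u} R, TorVanish R M N (n + 1)

/-- `cdLE R M n` : the cotorsion dimension of `M` is at most `n`, i.e.
`Ext^{n+1}_R(F, M) = 0` for every flat `R`-module `F`. -/
def cdLE (M : ModuleCat.{u} R) (n : ℕ) : Prop :=
  ∀ F : ModuleCat.{u} R, Module.Flat R F → ExtVanish R F M (n + 1)

/-- The projective dimension of a module, as an element of `ℕ∞`. -/
def pd (M : ModuleCat.{u} R) : ℕ∞ := sInf ((↑) '' {n : ℕ | pdLE R M n})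

/-- The injective dimension of a module, as an element of `ℕ∞`. -/
def injd (M : ModuleCat.{u} R) : ℕ∞ := sInf ((↑) '' {n : ℕ | idLE R M n})

/-- The flat dimension of a module, as an element of `ℕ∞`. -/
def fd (M : ModuleCat.{u} R) : ℕ∞ := sInf ((↑) '' {n : ℕ | fdLE R M n})

/-- The cotorsion dimension of a module, as an element of `ℕ∞`. -/
def cd (M : ModuleCat.{u} R) : ℕ∞ := sInf ((↑) '' {n : ℕ | cdLE R M n})

/-- The global dimension of a ring. -/
def gldim : ℕ∞ := ⨆ M : ModuleCat.{u} R, pd R M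

/-- The weak global dimension of a ring. -/
def wdim : ℕ∞ := ⨆ M : ModuleCat.{u} R, fd R M

/-- The global cotorsion dimension of a ring: the supremum of the projective
dimensions of all flat modules. -/
def cotD : ℕ∞ := ⨆ (M : ModuleCat.{u} R) (_ : Module.Flat R M), pd R M

/-- The finitistic projective dimension of a ring. -/
def FPD : ℕ∞ := sSup {d : ℕ∞ | d ≠ ⊤ ∧ ∃ M : ModuleCat.{u} R, pd R M = d}

/-- The finitistic flat dimension of a ring. -/
def FFD : ℕ∞ := sSup {d : ℕ∞ | d ≠ ⊤ ∧ ∃ M : ModuleCat.{u} R, fd R M = d}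

/-- The finitistic injective dimension of a ring. -/
def FID : ℕ∞ := sSup {d : ℕ∞ | d ≠ ⊤ ∧ ∃ M : ModuleCat.{u} R, injd R M = d}

/-- The finitistic cotorsion dimension of a ring. -/
def FCD : ℕ∞ := sSup {d : ℕ∞ | d ≠ ⊤ ∧ ∃ M : ModuleCat.{u} R, cd R M = d}

/-- `R` is `n`-perfect if every flat `R`-module has projective dimension at most `n`. -/
def IsNPerfect (n : ℕ) : Prop :=
  ∀ M : ModuleCat.{u} R, Module.Flat R M → pd R M ≤ n

end

instance : (Ideal.span {Polynomial.X} : Ideal (Polynomial ℚ)).IsPrime :=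
  (Ideal.span_singleton_prime Polynomial.X_ne_zero).mpr Polynomial.prime_X

/-- The discrete valuation ring `V = ℚ[X]_{(X)}`. -/
abbrev Vq : Type :=
  Localization.AtPrime (Ideal.span {Polynomial.X} : Ideal (Polynomial ℚ))

section
universe u
theorem extVanish_iff (R : Type u) [CommRing R] (M N : ModuleCat.{u} R) (n : ℕ) :
    ExtVanish R M N (n + 1) ↔ Subsingleton (Abelian.Ext.{u} M N (n + 1)) := by
  let P := projectiveResolution M
  have h1 : ExtVanish R M N (n + 1) ↔
      ∀ f : P.complex.X (n + 1) ⟶ N, P.complex.d (n + 2) (n + 1) ≫ f = 0 →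
        ∃ g : P.complex.X n ⟶ N, P.complex.d (n + 1) n ≫ g = f := by
    unfold ExtVanish
    rw [← ModuleCat.isZero_iff_subsingleton, (P.isoExt (R := R) (n + 1) N).isZero_iff,
      ← HomologicalComplex.exactAt_iff_isZero_homology,
      HomologicalComplex.exactAt_iff' _ n (n + 1) (n + 2) (by simp) (by simp),
      ShortComplex.moduleCat_exact_iff]
    rfl
  rw [h1]
  constructor
  · intro h
    refine subsingleton_of_forall_eq 0 fun x => ?_
    obtain ⟨f, hf, rfl⟩ := P.extMk_surjective x (n + 2) rfl
    rw [P.extMk_eq_zero_iff f _ _ hf n rfl]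
    exact h f hf
  · intro h f hf
    rw [← P.extMk_eq_zero_iff f _ rfl hf n rfl]
    exact Subsingleton.elim _ _

theorem pdLE_iff (R : Type u) [CommRing R] (M : ModuleCat.{u} R) (n : ℕ) :
    pdLE R M n ↔ HasProjectiveDimensionLT M (n + 1) := by
  unfold pdLE
  simp_rw [extVanish_iff]
  constructor
  · exact hasProjectiveDimensionLT_of_enoughInjectives M (n + 1)
  · intro h N
    exact HasProjectiveDimensionLT.subsingleton M (n + 1) (n + 1) le_rfl N

theorem pd_le_iff (R : Type u) [CommRing R] (M : ModuleCat.{u} R) (n : ℕ) :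
    pd R M ≤ n ↔ HasProjectiveDimensionLT M (n + 1) := by
  constructor
  · intro h
    by_cases hne : {n : ℕ | pdLE R M n}.Nonempty
    · have := csInf_mem (s := ((↑) '' {n : ℕ | pdLE R M n} : Set ℕ∞)) (hne.image _)
      obtain ⟨k, hk, hk'⟩ := this
      change _ = pd R M at hk'
      rw [← hk'] at h
      have := (pdLE_iff R M k).1 hk
      exact hasProjectiveDimensionLT_of_ge M (k + 1) (n + 1)
        (by have : k ≤ n := by exact_mod_cast h
            omega)
    · rw [Set.not_nonempty_iff_eq_empty] at hne
      simp [pd, hne] at h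
  · intro h
    exact sInf_le ⟨n, (pdLE_iff R M n).2 h, rfl⟩
end

section
universe u
open Abelian

theorem injective_of_ext_ideal {R : Type u} [CommRing R] (C : ModuleCat.{u} R)
    (h : ∀ I : Ideal R, Subsingleton (Ext.{u} (ModuleCat.of R (R ⧸ I)) C 1)) :
    Injective C := by
  rw [← Module.injective_iff_injective_object R C]
  apply Module.Baer.injective
  intro I g
  have ex : Function.Exact I.subtype (Submodule.mkQ I) := by
    rw [LinearMap.exact_iff]; simp
  let S : ShortComplex (ModuleCat.{u} R) :=
    ModuleCat.shortComplexOfCompEqZero I.subtype (Submodule.mkQ I) ex.linearMap_comp_eq_zero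
  have hS : S.ShortExact := ModuleCat.shortComplex_shortExact S ex I.injective_subtype
    (Submodule.mkQ_surjective _)
  let g' : S.X₁ ⟶ C := ModuleCat.ofHom g
  have : Subsingleton (Ext.{u} S.X₃ C 1) := h I
  obtain ⟨x, hx⟩ := Ext.contravariant_sequence_exact₁ hS C (Ext.mk₀ g') (n₁ := 1) (by simp)
    (Subsingleton.elim _ _)
  obtain ⟨k, rfl⟩ := (Ext.mk₀_bijective _ _).2 x
  rw [Ext.mk₀_comp_mk₀] at hx
  have hx := (Ext.mk₀_bijective _ _).1 hx
  refine ⟨k.hom, fun x mem => ?_⟩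
  have := congrArg (fun (t : S.X₁ ⟶ C) => t.hom (⟨x, mem⟩ : I)) hx
  exact this

theorem injDim_of_ext_ideal {R : Type u} [CommRing R] (n : ℕ) (C : ModuleCat.{u} R)
    (h : ∀ I : Ideal R, Subsingleton (Ext.{u} (ModuleCat.of R (R ⧸ I)) C (n + 1))) :
    HasInjectiveDimensionLT C (n + 1) := by
  induction n generalizing C with
  | zero =>
    rw [zero_add, ← injective_iff_hasInjectiveDimensionLT_one]
    exact injective_of_ext_ideal C h
  | succ n ih =>
    let ⟨p⟩ := EnoughInjectives.presentation C
    have hS : (ShortComplex.mk _ _ (Limits.cokernel.condition p.f)).ShortExact :=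
      { exact := ShortComplex.exact_cokernel p.f }
    refine (hS.hasInjectiveDimensionLT_X₃_iff n p.injective).1 (ih _ fun I => ?_)
    refine subsingleton_of_forall_eq 0 fun x => ?_
    have := h I
    obtain ⟨y, rfl⟩ := Ext.covariant_sequence_exact₃ (ModuleCat.of R (R ⧸ I)) hS x
      (n₁ := n + 1 + 1) rfl (Subsingleton.elim _ _)
    have : y = 0 := by
      have := p.injective
      exact Ext.eq_zero_of_injective y
    rw [this]; simp

theorem shortExact_of {R : Type u} [CommRing R] {A B C : Type u} [AddCommGroup A] [AddCommGroup B]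
    [AddCommGroup C] [Module R A] [Module R B] [Module R C] (f : A →ₗ[R] B) (g : B →ₗ[R] C)
    (hf : Function.Injective f) (hfg : Function.Exact f g) (hg : Function.Surjective g) :
    (ModuleCat.shortComplexOfCompEqZero f g hfg.linearMap_comp_eq_zero).ShortExact :=
  ModuleCat.shortComplex_shortExact _ hfg hf hg

/-- `A → B → C` exact. -/
theorem pdLT_two_of_exact {R : Type u} [CommRing R] {A B C : Type u} [AddCommGroup A]
    [AddCommGroup B]
    [AddCommGroup C] [Module R A] [Module R B] [Module R C] (f : A →ₗ[R] B) (g : B →ₗ[R] C)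
    (hf : Function.Injective f) (hfg : Function.Exact f g) (hg : Function.Surjective g)
    [Module.Projective R A] [Module.Projective R B] :
    HasProjectiveDimensionLT (ModuleCat.of R C) 2 := by
  have h1 : Projective (ModuleCat.of R A) := (IsProjective.iff_projective _).1 inferInstance
  have h2 : Projective (ModuleCat.of R B) := (IsProjective.iff_projective _).1 inferInstance
  exact ((shortExact_of f g hf hfg hg).hasProjectiveDimensionLT_X₃_iff 0 h2).2
    (projective_iff_hasProjectiveDimensionLT_one.1 h1)

theorem exact_ideal {R : Type u} [CommRing R] (I : Ideal R) :
    Function.Exact I.subtype (Submodule.mkQ I) := by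
  rw [LinearMap.exact_iff]; simp

theorem pdLT_three_of_ideals {R : Type u} [CommRing R]
    (h : ∀ I : Ideal R, HasProjectiveDimensionLT (ModuleCat.of R I) 2) (M : ModuleCat.{u} R) :
    HasProjectiveDimensionLT M 3 := by
  apply hasProjectiveDimensionLT_of_enoughInjectives
  intro N
  have h2 : Projective (ModuleCat.of R R) := (IsProjective.iff_projective _).1 inferInstance
  have : HasInjectiveDimensionLT N 3 := injDim_of_ext_ideal 2 N fun I => by
    have : HasProjectiveDimensionLT (ModuleCat.of R (R ⧸ I)) 3 :=
      ((shortExact_of _ _ I.injective_subtype (exact_ideal I)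
        (Submodule.mkQ_surjective _)).hasProjectiveDimensionLT_X₃_iff 1 h2).2 (h I)
    exact HasProjectiveDimensionLT.subsingleton _ 3 3 le_rfl N
  exact HasInjectiveDimensionLT.subsingleton N 3 3 le_rfl M

/-- Telescope data: an ascending chain of cyclic modules. -/
theorem exists_telescope {R : Type u} [CommRing R] [IsDomain R] {M : Type u} [AddCommGroup M]
    [Module R M] [Module.IsTorsionFree R M] (m : ℕ → M) (r : ℕ → R)
    (hm : ∀ n, m n = r n • m (n + 1)) (h0 : ∀ n, m n ≠ 0) (hs : ∀ x, ∃ n, ∃ a : R, x = a • m n) :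
    ∃ (f : (ℕ →₀ R) →ₗ[R] (ℕ →₀ R)) (g : (ℕ →₀ R) →ₗ[R] M),
      Function.Injective f ∧ Function.Exact f g ∧ Function.Surjective g := by
  let f : (ℕ →₀ R) →ₗ[R] (ℕ →₀ R) := Finsupp.linearCombination R
    (fun n => Finsupp.single n 1 - Finsupp.single (n + 1) (r n))
  let g : (ℕ →₀ R) →ₗ[R] M := Finsupp.linearCombination R m
  have hgf : ∀ x, g (f x) = 0 := by
    intro x
    have : g ∘ₗ f = 0 := by
      ext n
      simp [f, g, ← hm]
    exact LinearMap.congr_fun this x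
  -- coordinates of `f x`
  have hf0 : ∀ x, f x 0 = x 0 := by
    intro x
    have : Finsupp.lapply 0 ∘ₗ f = Finsupp.lapply 0 := by
      ext n
      simp [f, Finsupp.single_apply]
    exact LinearMap.congr_fun this x
  have hfs : ∀ x n, f x (n + 1) = x (n + 1) - r n * x n := by
    intro x n
    have : Finsupp.lapply (n + 1) ∘ₗ f = Finsupp.lapply (n + 1) - r n • Finsupp.lapply n := by
      ext k
      by_cases h : k = n
      · subst h; simp [f]
      · simp [f, Finsupp.single_apply, h]
    exact LinearMap.congr_fun this x
  -- modulo the image of `f`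
  have hred : ∀ x : ℕ →₀ R, ∃ N, ∀ k ≥ N, ∃ c : R, ∃ y, x = f y + Finsupp.single k c := by
    have step : ∀ n k (c : R), ∃ c' y, Finsupp.single n c = f y + Finsupp.single (n + k) c' := by
      intro n k c
      induction k with
      | zero => exact ⟨c, 0, by simp⟩
      | succ k ih =>
        obtain ⟨c', y, h⟩ := ih
        refine ⟨c' * r (n + k), y + Finsupp.single (n + k) c', ?_⟩
        rw [h, map_add]
        simp [f, smul_sub, add_assoc]
    intro x
    induction x using Finsupp.induction_linear with
    | zero => exact ⟨0, fun k _ => ⟨0, 0, by simp⟩⟩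
    | add x y hx hy =>
      obtain ⟨N, hN⟩ := hx
      obtain ⟨N', hN'⟩ := hy
      refine ⟨max N N', fun k hk => ?_⟩
      obtain ⟨c, a, h⟩ := hN k (by omega)
      obtain ⟨c', a', h'⟩ := hN' k (by omega)
      refine ⟨c + c', a + a', ?_⟩
      rw [h, h', map_add, Finsupp.single_add]; abel
    | single n c =>
      refine ⟨n, fun k hk => ?_⟩
      obtain ⟨d, rfl⟩ := Nat.exists_eq_add_of_le hk
      exact step n d c
  refine ⟨f, g, ?_, ?_, ?_⟩
  · rw [injective_iff_map_eq_zero]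
    intro x hx
    ext n
    induction n with
    | zero => rw [← hf0, hx]
    | succ n ih =>
      have := hfs x n
      rw [hx, ih] at this
      simpa using this.symm
  · intro x
    constructor
    · intro hx
      obtain ⟨N, hN⟩ := hred x
      obtain ⟨c, y, h⟩ := hN N le_rfl
      have : c • m N = 0 := by
        rw [h, map_add, hgf, zero_add] at hx
        simpa [g] using hx
      have hc : c = 0 := (smul_eq_zero.1 this).resolve_right (h0 N)
      exact ⟨y, by rw [h, hc]; simp⟩
    · rintro ⟨y, rfl⟩; exact hgf y
  · intro x
    obtain ⟨n, a, rfl⟩ := hs x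
    exact ⟨Finsupp.single n a, by simp [g]⟩

theorem exists_chain {R : Type u} [CommRing R] {M : Type u} [AddCommGroup M]
    [Module R M] [Countable M] [Nontrivial M]
    (hc : ∀ x y : M, ∃ z : M, ∃ a b : R, x = a • z ∧ y = b • z) :
    ∃ (m : ℕ → M) (r : ℕ → R), (∀ n, m n = r n • m (n + 1)) ∧ (∀ n, m n ≠ 0) ∧
      (∀ x, ∃ n, ∃ a : R, x = a • m n) := by
  obtain ⟨e, he⟩ := exists_surjective_nat M
  obtain ⟨m0, hm0⟩ := exists_ne (0 : M)
  choose z a b ha hb using hc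
  let m : ℕ → M := fun n => Nat.rec m0 (fun k x => z x (e k)) n
  have hms : ∀ n, m (n + 1) = z (m n) (e n) := fun n => rfl
  have h1 : ∀ n, m n = a (m n) (e n) • m (n + 1) := fun n => by rw [hms]; exact ha _ _
  refine ⟨m, fun n => a (m n) (e n), h1, ?_, ?_⟩
  · intro n
    induction n with
    | zero => exact hm0
    | succ n ih =>
      intro h
      apply ih
      rw [h1, h, smul_zero]
  · intro x
    obtain ⟨n, rfl⟩ := he x
    exact ⟨n + 1, b (m n) (e n), by rw [hms]; exact hb _ _⟩

theorem exists_telescope' {R : Type u} [CommRing R] [IsDomain R] {M : Type u} [AddCommGroup M]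
    [Module R M] [Module.IsTorsionFree R M] [Countable M] [Nontrivial M]
    (hc : ∀ x y : M, ∃ z : M, ∃ a b : R, x = a • z ∧ y = b • z) :
    ∃ (f : (ℕ →₀ R) →ₗ[R] (ℕ →₀ R)) (g : (ℕ →₀ R) →ₗ[R] M),
      Function.Injective f ∧ Function.Exact f g ∧ Function.Surjective g := by
  obtain ⟨m, r, h1, h2, h3⟩ := exists_chain hc
  exact exists_telescope m r h1 h2 h3

theorem pdLT_two_finsupp {R : Type u} [CommRing R] {A B C J : Type u} [AddCommGroup A]
    [AddCommGroup B]
    [AddCommGroup C] [Module R A] [Module R B] [Module R C] (f : A →ₗ[R] B) (g : B →ₗ[R] C)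
    (hf : Function.Injective f) (hfg : Function.Exact f g) (hg : Function.Surjective g)
    [Module.Projective R A] [Module.Projective R B] :
    HasProjectiveDimensionLT (ModuleCat.of R (J →₀ C)) 2 := by
  have p (A : Type u) [AddCommGroup A] [Module R A] [Module.Projective R A] :
      Module.Projective R (J →₀ A) := by
    classical
    exact Module.Projective.of_equiv (finsuppLequivDFinsupp (M := A) (ι := J) R).symm
  have := p A
  have := p B
  refine pdLT_two_of_exact (Finsupp.mapRange.linearMap (α := J) f)
    (Finsupp.mapRange.linearMap g) ?_ ?_ ?_
  · exact Finsupp.mapRange_injective _ (map_zero f) hf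
  · intro x
    constructor
    · intro hx
      have h (j : J) : ∃ y, f y = x j := by
        rw [← Set.mem_range, ← hfg]
        exact DFunLike.congr_fun hx j
      choose y hy using h
      classical
      refine ⟨Finsupp.onFinset x.support (fun j => y j) ?_, ?_⟩
      · intro j hj
        rw [Finsupp.mem_support_iff, ← hy]
        intro h
        exact hj (hf (by rw [h, map_zero]))
      · ext j
        simp [hy]
    · rintro ⟨y, rfl⟩
      ext j
      simp [hfg.apply_apply_eq_zero]
  · exact Finsupp.mapRange_surjective _ (map_zero g) hg
end
section
universe u
open Abelian

theorem bezout_cyclic {R : Type u} [CommRing R] [IsBezout R] (x y : R) :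
    ∃ z ∈ Ideal.span {x, y}, ∃ a b : R, x = a * z ∧ y = b * z := by
  obtain ⟨z, hz⟩ := (IsBezout.iff_span_pair_isPrincipal (R := R)).1 inferInstance x y
  have h1 : z ∈ Ideal.span {x, y} := by rw [hz]; exact Submodule.mem_span_singleton_self z
  have hx : x ∈ Ideal.span {x, y} := Ideal.subset_span (by simp)
  have hy : y ∈ Ideal.span {x, y} := Ideal.subset_span (by simp)
  rw [hz] at hx hy
  obtain ⟨a, ha⟩ := Submodule.mem_span_singleton.1 hx
  obtain ⟨b, hb⟩ := Submodule.mem_span_singleton.1 hy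
  exact ⟨z, h1, a, b, ha.symm, hb.symm⟩

theorem bezout_ideal_pd {R : Type u} [CommRing R] [IsDomain R] [IsBezout R] [Countable R]
    (I : Ideal R) : HasProjectiveDimensionLT (ModuleCat.of R I) 2 := by
  rcases subsingleton_or_nontrivial I with h | h
  · have : Module.Projective R I := inferInstance
    have h1 : Projective (ModuleCat.of R I) := (IsProjective.iff_projective _).1 inferInstance
    infer_instance
  · obtain ⟨f, g, hf, hfg, hg⟩ := exists_telescope' (R := R) (M := I) (by
      rintro ⟨x, hx⟩ ⟨y, hy⟩
      obtain ⟨z, hz, a, b, ha, hb⟩ := bezout_cyclic x y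
      have : z ∈ I := by
        refine (Ideal.span_le.2 ?_) hz
        rintro t (rfl | rfl) <;> assumption
      exact ⟨⟨z, this⟩, a, b, Subtype.ext ha, Subtype.ext hb⟩)
    exact pdLT_two_of_exact f g hf hfg hg

theorem bezout_pd {R : Type u} [CommRing R] [IsDomain R] [IsBezout R] [Countable R]
    (M : ModuleCat.{u} R) : HasProjectiveDimensionLT M 3 :=
  pdLT_three_of_ideals bezout_ideal_pd M

theorem fraction_cyclic {R : Type u} [CommRing R] [IsDomain R] [IsBezout R] (K : Type u) [Field K]
    [Algebra R K] [IsFractionRing R K] (x y : K) :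
    ∃ z : K, ∃ a b : R, x = a • z ∧ y = b • z := by
  classical
  obtain ⟨d, hd⟩ := IsLocalization.exist_integer_multiples_of_finset (nonZeroDivisors R)
    ({x, y} : Finset K)
  obtain ⟨x', hx⟩ := hd x (by simp)
  obtain ⟨y', hy⟩ := hd y (by simp)
  obtain ⟨z, hz, a, b, ha, hb⟩ := bezout_cyclic x' y'
  have hd0 : algebraMap R K d ≠ 0 := by simp
  refine ⟨algebraMap R K z / algebraMap R K d, a, b, ?_, ?_⟩
  · rw [Algebra.smul_def] at hx ⊢
    rw [ha, map_mul] at hx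
    field_simp
    rw [hx]
    exact mul_comm _ _
  · rw [Algebra.smul_def] at hy ⊢
    rw [hb, map_mul] at hy
    field_simp
    rw [hy]
    exact mul_comm _ _

theorem bezout_flat_pd {R : Type u} [CommRing R] [IsDomain R] [IsBezout R] [Countable R]
    (F : ModuleCat.{u} R) [Module.Flat R F] : HasProjectiveDimensionLT F 2 := by
  let K := FractionRing R
  let E := TensorProduct R K F
  have : Countable K := (IsLocalization.mk'_surjective (nonZeroDivisors R)).countable
    (f := fun x : R × nonZeroDivisors R => IsLocalization.mk' K x.1 x.2)
  let J := Module.Free.ChooseBasisIndex K E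
  let e : E ≃ₗ[R] (J →₀ K) := (Module.Free.chooseBasis K E).repr.restrictScalars R
  obtain ⟨f, g, hf, hfg, hg⟩ := exists_telescope' (R := R) (M := K) (fraction_cyclic K)
  have h2 : HasProjectiveDimensionLT (ModuleCat.of R (J →₀ K)) 2 :=
    pdLT_two_finsupp f g hf hfg hg
  let i : F →ₗ[R] E := (TensorProduct.mk R K F 1)
  have hi : Function.Injective i := by
    have h := Module.Flat.rTensor_preserves_injective_linearMap (M := F) (Algebra.linearMap R K)
      (IsFractionRing.injective R K)
    have : i = (Algebra.linearMap R K).rTensor F ∘ₗ (TensorProduct.lid R F).symm.toLinearMap := by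
      ext x; simp [i]; rfl
    rw [this]
    exact h.comp (TensorProduct.lid R F).symm.injective
  let j : F →ₗ[R] (J →₀ K) := e.toLinearMap ∘ₗ i
  have hj : Function.Injective j := e.injective.comp hi
  have hS := shortExact_of j (Submodule.mkQ (LinearMap.range j)) hj j.exact_map_mkQ_range
    (Submodule.mkQ_surjective _)
  exact hS.hasProjectiveDimensionLT_X₁ 2 h2 (bezout_pd _)

theorem flat_of_torsionFree {R : Type u} [CommRing R] [IsDomain R] [IsBezout R] {M : Type u}
    [AddCommGroup M] [Module R M] [Module.IsTorsionFree R M] : Module.Flat R M := by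
  rw [Module.Flat.flat_iff_torsion_eq_bot_of_isBezout]
  rw [eq_bot_iff]
  rintro x ⟨a, ha⟩
  have : (a : R) • x = 0 := ha
  exact (smul_eq_zero.1 this).resolve_left (nonZeroDivisors.ne_zero a.2)

/-- Tor via a projective resolution. -/
theorem torVanish_iff {R : Type u} [CommRing R] (M N : ModuleCat.{u} R) (P : ProjectiveResolution N)
    (n : ℕ) : TorVanish R M N (n + 1) ↔
    Function.Exact ((P.complex.d (n + 2) (n + 1)).hom.lTensor M)
      ((P.complex.d (n + 1) n).hom.lTensor M) := by
  unfold TorVanish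
  rw [← ModuleCat.isZero_iff_subsingleton]
  dsimp only [Tor]
  rw [(P.isoLeftDerivedObj ((MonoidalCategory.tensoringLeft (ModuleCat.{u} R)).obj M)
      (n + 1)).isZero_iff]
  dsimp only [HomologicalComplex.homologyFunctor]
  rw [← HomologicalComplex.exactAt_iff_isZero_homology,
      HomologicalComplex.exactAt_iff' _ (n + 2) (n + 1) n (by simp) (by simp),
      ShortComplex.ShortExact.moduleCat_exact_iff_function_exact]
  rfl

theorem res_exact {R : Type u} [CommRing R] {N : ModuleCat.{u} R} (P : ProjectiveResolution N)
    (n : ℕ) :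
    Function.Exact (P.complex.d (n + 2) (n + 1)).hom (P.complex.d (n + 1) n).hom := by
  have := (P.exact_succ n)
  rw [ShortComplex.ShortExact.moduleCat_exact_iff_function_exact] at this
  exact this
end
section
universe u
open Abelian

theorem res_projective {R : Type u} [CommRing R] {N : ModuleCat.{u} R} (P : ProjectiveResolution N)
    (n : ℕ) : Module.Projective R (P.complex.X n) :=
  (IsProjective.iff_projective _).2 (P.projective n)

theorem bezout_tor_two {R : Type u} [CommRing R] [IsDomain R] [IsBezout R]
    (M N : ModuleCat.{u} R) : TorVanish R M N 2 := by
  let P := projectiveResolution N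
  rw [torVanish_iff M N P 1]
  have e1 := res_exact P 0
  have e2 := res_exact P 1
  have := res_projective P 0
  let d1 := (P.complex.d 1 0).hom
  let d2 := (P.complex.d 2 1).hom
  let d3 := (P.complex.d 3 2).hom
  change Function.Exact d2 d1 at e1
  change Function.Exact d3 d2 at e2
  change Function.Exact (d3.lTensor M) (d2.lTensor M)
  have : Module.IsTorsionFree R (LinearMap.range d1) := inferInstance
  have : Module.Flat R (LinearMap.range d1) := flat_of_torsionFree
  have hinj : Function.Injective ((LinearMap.range d2).subtype.lTensor M) := by
    refine LinearMap.lTensor_injective_of_exact_of_flat d1.rangeRestrict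
      d1.surjective_rangeRestrict _ (Submodule.injective_subtype _) ?_ M
    intro x
    rw [Subtype.ext_iff]
    simpa using e1 x
  have hex : Function.Exact (d3.lTensor M) (d2.rangeRestrict.lTensor M) := by
    refine lTensor_exact M ?_ d2.surjective_rangeRestrict
    intro x
    rw [Subtype.ext_iff]
    simpa using e2 x
  have hcomp : d2.lTensor M = (LinearMap.range d2).subtype.lTensor M ∘ₗ
      d2.rangeRestrict.lTensor M := by
    rw [← LinearMap.lTensor_comp]; rfl
  intro x
  rw [← hex x, hcomp, LinearMap.comp_apply]
  constructor
  · intro h; exact hinj (by rw [h, map_zero])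
  · intro h; rw [h, map_zero]

theorem res_exact0 {R : Type u} [CommRing R] {N : ModuleCat.{u} R} (P : ProjectiveResolution N) :
    Function.Exact (P.complex.d 1 0).hom (P.π.f 0).hom := by
  have := ShortComplex.exact_of_g_is_cokernel
    (ShortComplex.mk _ _ P.complex_d_comp_π_f_zero) P.isColimitCokernelCofork
  rw [ShortComplex.ShortExact.moduleCat_exact_iff_function_exact] at this
  exact this

theorem mem_smul_of_tmul {R : Type u} [CommRing R] (t : R) {A : Type u} [AddCommGroup A]
    [Module R A] (y : A)
    (h : (1 : R ⧸ Ideal.span {t}) ⊗ₜ[R] y = (0 : TensorProduct R (R ⧸ Ideal.span {t}) A)) :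
    ∃ z, y = t • z := by
  have := congrArg (TensorProduct.quotTensorEquivQuotSMul A (Ideal.span {t})) h
  rw [TensorProduct.quotTensorEquivQuotSMul_mk_one_tmul, map_zero, Submodule.Quotient.mk_eq_zero,
    Submodule.ideal_span_singleton_smul] at this
  obtain ⟨z, -, hz⟩ := this
  exact ⟨z, hz.symm⟩

theorem exists_tmul_one {R : Type u} [CommRing R] (t : R) {A : Type u} [AddCommGroup A]
    [Module R A] (w : TensorProduct R (R ⧸ Ideal.span {t}) A) :
    ∃ y : A, w = 1 ⊗ₜ[R] y := by
  obtain ⟨y, hy⟩ := Submodule.mkQ_surjective _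
    (TensorProduct.quotTensorEquivQuotSMul A (Ideal.span {t}) w)
  refine ⟨y, ?_⟩
  apply (TensorProduct.quotTensorEquivQuotSMul A (Ideal.span {t})).injective
  rw [TensorProduct.quotTensorEquivQuotSMul_mk_one_tmul, ← hy]
  rfl

theorem tor_one_ne {R : Type u} [CommRing R] [IsDomain R] (t : R) (ht0 : t ≠ 0)
    (ht : ¬ IsUnit t) :
    ¬ TorVanish R (ModuleCat.of R (R ⧸ Ideal.span {t})) (ModuleCat.of R (R ⧸ Ideal.span {t})) 1 := by
  intro h
  let P := projectiveResolution (ModuleCat.of R (R ⧸ Ideal.span {t}))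
  rw [torVanish_iff _ _ P 0] at h
  have e1 := res_exact P 0
  have e0 := res_exact0 P
  have := res_projective P 0
  let d1 := (P.complex.d 1 0).hom
  let d2 := (P.complex.d 2 1).hom
  let p : P.complex.X 0 →ₗ[R] (R ⧸ Ideal.span {t}) := (P.π.f 0).hom
  change Function.Exact d2 d1 at e1
  change Function.Exact d1 p at e0
  change Function.Exact (d2.lTensor (R ⧸ Ideal.span {t})) (d1.lTensor (R ⧸ Ideal.span {t})) at h
  have hp : Function.Surjective p := (ModuleCat.epi_iff_surjective (P.π.f 0)).1 inferInstance
  have tz : ∀ {A : Type u} [AddCommGroup A] [Module R A] (y : A),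
      (1 : R ⧸ Ideal.span {t}) ⊗ₜ[R] (t • y) = 0 := by
    intro A _ _ y
    rw [TensorProduct.tmul_smul, TensorProduct.smul_tmul']
    have : t • (1 : R ⧸ Ideal.span {t}) = 0 := by
      rw [Algebra.smul_def, mul_one]
      exact Ideal.Quotient.eq_zero_iff_mem.2 (Ideal.mem_span_singleton_self t)
    rw [this, TensorProduct.zero_tmul]
  have key : ∀ q, ∃ y, d1 y = q := by
    intro q
    have : p (t • q) = 0 := by
      obtain ⟨s, hs⟩ := Ideal.Quotient.mk_surjective (p q)
      rw [map_smul, ← hs, Algebra.smul_def]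
      change Ideal.Quotient.mk _ t * _ = _
      rw [← map_mul]
      exact Ideal.Quotient.eq_zero_iff_mem.2
        (Ideal.mul_mem_right _ _ (Ideal.mem_span_singleton_self t))
    obtain ⟨y, hy⟩ := (e0 _).1 this
    have h1 : d1.lTensor (R ⧸ Ideal.span {t}) (1 ⊗ₜ y) = 0 := by
      rw [LinearMap.lTensor_tmul, hy, tz]
    obtain ⟨w, hw⟩ := (h _).1 h1
    obtain ⟨w, rfl⟩ := exists_tmul_one t w
    rw [LinearMap.lTensor_tmul] at hw
    obtain ⟨z, hz⟩ := mem_smul_of_tmul t (y - d2 w) (by rw [TensorProduct.tmul_sub, hw, sub_self])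
    refine ⟨z, ?_⟩
    have h2 : t • d1 z = t • q := by
      rw [← map_smul, ← hz, map_sub, e1.apply_apply_eq_zero, hy, sub_zero]
    have h3 : t • (d1 z - q) = 0 := by rw [smul_sub, h2, sub_self]
    exact sub_eq_zero.1 ((smul_eq_zero.1 h3).resolve_left ht0)
  obtain ⟨q, hq⟩ := hp 1
  obtain ⟨y, rfl⟩ := key q
  rw [e0.apply_apply_eq_zero] at hq
  have h1 : (Ideal.Quotient.mk (Ideal.span {t})) 1 = 0 := by rw [map_one, hq]
  rw [Ideal.Quotient.eq_zero_iff_mem, Ideal.mem_span_singleton] at h1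
  exact ht (isUnit_of_dvd_one h1)

theorem assembly {R : Type u} [CommRing R] [IsDomain R] [IsBezout R] [Countable R]
    (t : R) (ht0 : t ≠ 0) (ht : ¬ IsUnit t) (I : Ideal R) (hI : ¬ Module.Projective R I) :
    gldim R = 2 ∧ wdim R = 1 ∧ cotD R = 1 := by
  have h2 : Projective (ModuleCat.of R R) := (IsProjective.iff_projective _).1 inferInstance
  have hI' : ¬ HasProjectiveDimensionLT (ModuleCat.of R I) 1 := by
    rw [← projective_iff_hasProjectiveDimensionLT_one, ← IsProjective.iff_projective]
    exact hI
  refine ⟨le_antisymm ?_ ?_, le_antisymm ?_ ?_, le_antisymm ?_ ?_⟩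
  · exact iSup_le fun M => (pd_le_iff R M 2).2 (bezout_pd M)
  · refine le_trans ?_ (le_iSup _ (ModuleCat.of R (R ⧸ I)))
    by_contra hlt
    have : pd R (ModuleCat.of R (R ⧸ I)) ≤ (1 : ℕ) :=
      Order.le_of_lt_add_one (lt_of_lt_of_eq (not_le.1 hlt) (by norm_num))
    rw [pd_le_iff] at this
    exact hI' (((shortExact_of _ _ I.injective_subtype (exact_ideal I)
        (Submodule.mkQ_surjective _)).hasProjectiveDimensionLT_X₃_iff 0 h2).1 this)
  · refine iSup_le fun M => sInf_le ⟨1, fun N => bezout_tor_two M N, rfl⟩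
  · refine le_trans ?_ (le_iSup _ (ModuleCat.of R (R ⧸ Ideal.span {t})))
    refine le_sInf ?_
    rintro _ ⟨n, hn, rfl⟩
    rcases n with _ | n
    · exact absurd (hn _) (tor_one_ne t ht0 ht)
    · simp
  · exact iSup_le fun M => iSup_le fun hM => (pd_le_iff R M 1).2 (bezout_flat_pd M)
  · have : Module.Flat R I := flat_of_torsionFree
    refine le_trans ?_ (le_iSup_of_le (ModuleCat.of R I) (le_iSup_of_le this le_rfl))
    by_contra hlt
    have : pd R (ModuleCat.of R I) ≤ (0 : ℕ) :=
      Order.le_of_lt_add_one (lt_of_lt_of_eq (not_le.1 hlt) (by norm_num))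
    rw [pd_le_iff] at this
    exact hI' this
end
section concrete
open Polynomial

theorem Vq_ev : ∃ ev : Vq →+* ℚ, (∀ x, ev x = 0 ↔
    x ∈ Ideal.span {algebraMap (Polynomial ℚ) Vq Polynomial.X}) ∧
    (∀ q : ℚ, ev (algebraMap (Polynomial ℚ) Vq (C q)) = q) := by
  let M := (Ideal.span {X} : Ideal (Polynomial ℚ)).primeCompl
  have hu : ∀ y : M, IsUnit ((Polynomial.evalRingHom (0 : ℚ)) y) := by
    rintro ⟨y, hy⟩
    rw [isUnit_iff_ne_zero]
    intro h
    apply hy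
    rw [SetLike.mem_coe, Ideal.mem_span_singleton, Polynomial.X_dvd_iff, Polynomial.coeff_zero_eq_eval_zero]
    exact h
  let ev : Vq →+* ℚ := IsLocalization.lift (M := M) hu
  refine ⟨ev, ?_, ?_⟩
  · intro x
    constructor
    · intro h
      obtain ⟨p, s, rfl⟩ := IsLocalization.exists_mk'_eq M x
      rw [IsLocalization.lift_mk'_spec] at h
      have hp : p.coeff 0 = 0 := by
        rw [Polynomial.coeff_zero_eq_eval_zero]; simpa using h
      rw [← Polynomial.X_dvd_iff] at hp
      obtain ⟨q, rfl⟩ := hp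
      rw [← IsLocalization.mul_mk'_eq_mk'_of_mul]
      exact Ideal.mul_mem_right _ _ (Ideal.mem_span_singleton_self _)
    · intro h
      obtain ⟨y, rfl⟩ := Ideal.mem_span_singleton'.1 h
      rw [map_mul]
      simp [ev]
  · intro q
    simp [ev]

theorem Vq_countable : Countable Vq := by
  have : Countable (Polynomial ℚ) :=
    (Polynomial.basisMonomials ℚ).repr.injective.countable
  exact (IsLocalization.mk'_surjective (Ideal.span {X} : Ideal (Polynomial ℚ)).primeCompl).countable
   (f := fun x : ℚ[X] × (Ideal.span {X} : Ideal (Polynomial ℚ)).primeCompl =>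
     IsLocalization.mk' Vq x.1 x.2)

theorem Vq_domain : IsDomain Vq := inferInstance
theorem Vq_val : ∀ a b : Vq, a ∣ b ∨ b ∣ a := by
  have : IsDiscreteValuationRing Vq :=
    IsLocalization.AtPrime.isDiscreteValuationRing_of_dedekind_domain (Polynomial ℚ)
      (P := Ideal.span {X}) (by simp) Vq
  exact ValuationRing.dvd_total

theorem concrete_assembly (R : Subring Vq) (ev : Vq →+* ℚ) (hev : ∀ x, ev x = 0 ↔
      x ∈ Ideal.span {algebraMap (Polynomial ℚ) Vq Polynomial.X})
    (hR' : ∀ x : Vq, x ∈ R ↔ ∃ n : ℤ,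
      x - (n : Vq) ∈ Ideal.span {algebraMap (Polynomial ℚ) Vq Polynomial.X})
    (i : ℚ → Vq) (hi : ∀ q, ev (i q) = q) (hi1 : ∀ n : ℕ, n ≠ 0 → (n : Vq) * i ((n : ℚ)⁻¹) = 1) :
    gldim R = 2 ∧ wdim R = 1 ∧ cotD R = 1 := by
  have hR : ∀ x : Vq, x ∈ R ↔ ∃ n : ℤ, ev x = n := by
    intro x
    rw [hR']
    refine exists_congr fun n => ?_
    rw [← hev, map_sub, map_intCast, sub_eq_zero]
  have hRZ : ∀ x : R, ∃ n : ℤ, ev x = n := fun x => (hR x).1 x.2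
  have hev0 : ∀ x, ev x = 0 → x ∈ R := fun x hx => (hR x).2 ⟨0, by simpa using hx⟩
  have : Countable Vq := Vq_countable
  have hcount : Countable R := inferInstance
  -- Bezout
  have main : ∀ a b : R, (a : Vq) ∣ b → ∃ g ∈ Ideal.span {a, b}, g ∣ a ∧ g ∣ b := by
    intro a b ⟨c, hc⟩
    obtain ⟨n, hn⟩ := hRZ a
    obtain ⟨m, hm⟩ := hRZ b
    let p : ℤ := (ev c).num
    let q : ℕ := (ev c).den
    have hq0 : (q : ℕ) ≠ 0 := (ev c).den_ne_zero
    have hqQ : (q : ℚ) ≠ 0 := by exact_mod_cast hq0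
    have hpq : ev c * q = p := Rat.mul_den_eq_num (ev c)
    have hcop : IsCoprime (q : ℤ) p := by
      have h := (ev c).reduced
      exact (Int.isCoprime_iff_gcd_eq_one.2 (by simpa [Int.gcd, Nat.Coprime] using h)).symm
    let w := i ((q : ℚ)⁻¹)
    have hqw : (q : Vq) * w = 1 := hi1 q hq0
    have hew : ev w = (q : ℚ)⁻¹ := hi _
    have hdvd : (q : ℤ) ∣ n := by
      refine hcop.dvd_of_dvd_mul_right (z := p) ⟨m, ?_⟩
      have h1 : ev b = ev a * ev c := by rw [hc, map_mul]
      rw [hn, hm] at h1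
      have : (n : ℚ) * p = q * m := by rw [← hpq, h1]; ring
      exact_mod_cast this
    obtain ⟨k, hk⟩ := hdvd
    have hg : (a : Vq) * w ∈ R := by
      rw [hR]
      refine ⟨k, ?_⟩
      rw [map_mul, hn, hew, hk]
      push_cast
      field_simp
    have hqc : (q : Vq) * c ∈ R := by
      rw [hR]
      refine ⟨p, ?_⟩
      rw [map_mul, map_natCast, mul_comm, hpq]
    have hd : c - p * w ∈ R := by
      apply hev0
      rw [map_sub, map_mul, map_intCast, hew, ← hpq]
      field_simp
      ring
    obtain ⟨u, v, huv⟩ := hcop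
    have huv' : (u : Vq) * q + v * p = 1 := by exact_mod_cast congrArg (Int.cast : ℤ → Vq) huv
    refine ⟨⟨_, hg⟩, ?_, ⟨(q : R), ?_⟩, ⟨⟨_, hqc⟩, ?_⟩⟩
    · rw [Ideal.mem_span_pair]
      refine ⟨(u : R) - (v : R) * ⟨_, hd⟩, v, ?_⟩
      apply Subtype.ext
      push_cast
      rw [hc]
      linear_combination (a : Vq) * w * huv' - (a : Vq) * u * hqw
    · apply Subtype.ext
      push_cast
      linear_combination -(a : Vq) * hqw
    · apply Subtype.ext
      push_cast
      rw [hc]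
      linear_combination -(a : Vq) * c * hqw
  have princ : ∀ a b : R, (∃ g ∈ Ideal.span {a, b}, g ∣ a ∧ g ∣ b) →
      (Ideal.span {a, b}).IsPrincipal := by
    rintro a b ⟨g, hg, ha, hb⟩
    refine ⟨g, le_antisymm ?_ ?_⟩
    · rw [Ideal.span_le]
      rintro x (rfl | rfl)
      · exact Ideal.mem_span_singleton.2 ha
      · exact Ideal.mem_span_singleton.2 hb
    · exact (Ideal.span_singleton_le_iff_mem _).2 hg
  have : IsBezout R := by
    rw [IsBezout.iff_span_pair_isPrincipal]
    intro a b
    rcases Vq_val a b with h | h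
    · exact princ a b (main a b h)
    · rw [Set.pair_comm]
      exact princ b a (main b a h)
  -- the ideal `X V`
  let x0 : Vq := algebraMap (Polynomial ℚ) Vq Polynomial.X
  have hx0 : ev x0 = 0 := (hev _).2 (Ideal.mem_span_singleton_self _)
  have hx0' : x0 ≠ 0 := by
    intro h
    have : algebraMap (Polynomial ℚ) Vq Polynomial.X = algebraMap (Polynomial ℚ) Vq 0 := by
      rw [map_zero]; exact h
    exact Polynomial.X_ne_zero (IsLocalization.injective Vq
      (Ideal.primeCompl_le_nonZeroDivisors (Ideal.span {Polynomial.X} : Ideal (Polynomial ℚ))) this)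
  let I : Ideal R := RingHom.ker (ev.comp R.subtype)
  have hI : ∀ y : R, y ∈ I ↔ ev y = 0 := fun y => Iff.rfl
  refine assembly (2 : R) ?_ ?_ I ?_
  · intro h
    have := congrArg (fun z : R => ev z) h
    have h2 : ev ((2 : R) : Vq) = 2 := by
      have : ((2 : R) : Vq) = 2 := rfl
      rw [this, map_ofNat]
    simp only [h2] at this
    simp at this
  · intro h
    obtain ⟨b, hb⟩ := h.exists_right_inv
    obtain ⟨n, hn⟩ := hRZ b
    have := congrArg (fun z : R => ev z) hb
    simp only [Subring.coe_mul, map_mul, hn, Subring.coe_one, map_one] at this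
    have h2 : ev ((2 : R) : Vq) = 2 := by
      have : ((2 : R) : Vq) = 2 := rfl
      rw [this, map_ofNat]
    rw [h2] at this
    have : (2 : ℤ) * n = 1 := by exact_mod_cast this
    omega
  · intro hproj
    obtain ⟨s, hs⟩ := Module.projective_def'.1 hproj
    let X0 : I := ⟨⟨x0, hev0 _ hx0⟩, hx0⟩
    -- the coordinates of `X0` lie in `I`
    have hcoord : ∀ y : I, ev (s X0 y : R) = 0 := by
      intro y
      obtain ⟨n, hn⟩ := hRZ (s X0 y)
      have hdiv : ∀ k : ℕ, k ≠ 0 → (k : ℤ) ∣ n := by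
        intro k hk
        have hz : ev (i ((k : ℚ)⁻¹) * x0) = 0 := by rw [map_mul, hx0, mul_zero]
        let Z : I := ⟨⟨_, hev0 _ hz⟩, hz⟩
        have hZ : X0 = (k : R) • Z := by
          apply Subtype.ext
          apply Subtype.ext
          change x0 = ((k : R) : Vq) * (i ((k : ℚ)⁻¹) * x0)
          push_cast
          linear_combination -x0 * hi1 k hk
        obtain ⟨m, hm⟩ := hRZ (s Z y)
        refine ⟨m, ?_⟩
        rw [hZ, map_smul, Finsupp.smul_apply, smul_eq_mul, Subring.coe_mul, map_mul, hm] at hn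
        have : ev ((k : R) : Vq) = k := by push_cast; rw [map_natCast]
        rw [this] at hn
        exact_mod_cast hn.symm
      have hn0 : n = 0 := by
        have := Int.le_of_dvd (a := ((n.natAbs + 1 : ℕ) : ℤ)) (b := |n|)
        by_contra hne
        have h1 := this (abs_pos.2 hne) ((dvd_abs _ _).2 (hdiv _ (by omega)))
        rw [Int.abs_eq_natAbs] at h1
        push_cast at h1
        omega
      rw [hn, hn0]; simp
    have hX : X0 = (s X0).sum fun y c => c • y := by
      have := LinearMap.congr_fun hs X0
      simpa [Finsupp.linearCombination_apply] using this.symm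
    have hmem : ∀ z : Vq, ev z = 0 → x0 ∣ z := fun z hz => Ideal.mem_span_singleton.1 ((hev z).1 hz)
    have hdvd : x0 * x0 ∣ x0 := by
      have h1 : x0 = (s X0).sum fun y c => ((c : R) : Vq) * ((y : R) : Vq) := by
        have := congrArg (fun z : I => ((z : R) : Vq)) hX
        refine this.trans ?_
        simp only [Finsupp.sum]
        push_cast
        rfl
      have h2 : x0 * x0 ∣ (s X0).sum fun y c => ((c : R) : Vq) * ((y : R) : Vq) :=
        Finset.dvd_sum fun y _ => mul_dvd_mul (hmem _ (hcoord y)) (hmem _ y.2)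
      rwa [← h1] at h2
    obtain ⟨e, he⟩ := hdvd
    have h1 : x0 * e = 1 := by
      apply mul_left_cancel₀ hx0'
      rw [← mul_assoc, ← he, mul_one]
    have := congrArg ev h1
    rw [map_mul, hx0, zero_mul, map_one] at this
    exact zero_ne_one this
end concrete

/-- For `V = ℚ[X]_{(X)} = ℚ + XV` and `R = ℤ + XV` one has `gldim R = 2`,
`wdim R = 1` and `cot.D R = 1`; in particular `cot.D R < gldim R` and
`gldim R = cot.D R + wdim R`. -/
theorem stmt_18 (R : Subring Vq)
    (hR : ∀ x : Vq, x ∈ R ↔ ∃ n : ℤ,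
      x - (n : Vq) ∈ Ideal.span {algebraMap (Polynomial ℚ) Vq Polynomial.X}) :
    gldim R = 2 ∧ wdim R = 1 ∧ cotD R = 1 ∧
      cotD R < gldim R ∧ gldim R = cotD R + wdim R := by
  obtain ⟨ev, h1, h2⟩ := Vq_ev
  obtain ⟨g, w, c⟩ := concrete_assembly R ev h1 hR
    (fun q => algebraMap (Polynomial ℚ) Vq (Polynomial.C q)) h2 (by
      intro n hn
      have hq : (n : ℚ) ≠ 0 := by exact_mod_cast hn
      rw [← map_natCast (algebraMap (Polynomial ℚ) Vq), ← map_natCast Polynomial.C, ← map_mul,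
        ← map_mul, mul_inv_cancel₀ hq, map_one, map_one])
  rw [g, w, c]
  refine ⟨rfl, rfl, rfl, ?_, ?_⟩ <;> norm_num
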